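/- arXiv:1407.3200 — 3 statements merged into one kernel-verified Lean document; each statement's English description precedes it below -/
import Mathlib

section
/- There exists a constant C > 0 such that for every rotor-router system on a finite connected graph with m edges, carrying k ≥ 1 tokens, and every initial state S_0, there exists T ≤ C·m⁵·k² such that the state S_T is stable. -/
open Finset

namespace RotorRouter

variable {V : Type} [Fintype V] [DecidableEq V] (G : SimpleGraph V) [DecidableRel G.Adj]

/-- The outgoing arcs (darts) of a vertex `v`. -/
def outArcs (v : V) : Finset G.Dart := Finset.univ.filter (fun d => d.fst = v)

/-- The incoming arcs (darts) of a vertex `v`. -/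
def inArcs (v : V) : Finset G.Dart := Finset.univ.filter (fun d => d.snd = v)

/-- A state of the rotor-router system: at each vertex, the current pointer
(represented as an index, in the fixed cyclic order, of an outgoing arc) and the
number of tokens currently located at the vertex. -/
structure State where
  ptr : V → ℕ
  tokens : V → ℕ
  ptr_lt : ∀ v : V, 0 < G.degree v → ptr v < G.degree v

variable (ord : ∀ v : V, Fin (G.degree v) ≃ {d : G.Dart // d.fst = v})

/-- The number of tokens sent out on the `j`-th outgoing arc when `k` tokens leave a
vertex of degree `deg` in round-robin fashion, starting from pointer position `p`. -/
def sentCount (deg p k j : ℕ) : ℕ :=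
  ((Finset.range k).filter (fun i => (p + i) % deg = j)).card

/-- The number of tokens sent along the arc `d` during one step from state `S`. -/
def arcLoad (S : State G) (d : G.Dart) : ℕ :=
  sentCount (G.degree d.fst) (S.ptr d.fst) (S.tokens d.fst)
    (((ord d.fst).symm ⟨d, rfl⟩ : Fin (G.degree d.fst)) : ℕ)

/-- One synchronous step of the rotor-router system: every vertex sends out all of its
tokens in round-robin fashion, advancing its pointer after each token. -/
def step (S : State G) : State G where
  ptr v := if 0 < G.degree v then (S.ptr v + S.tokens v) % G.degree v else S.ptr v
  tokens v := (∑ d ∈ inArcs G v, arcLoad G ord S d) +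
    (if 0 < G.degree v then 0 else S.tokens v)
  ptr_lt v h := by simp only [if_pos h]; exact Nat.mod_lt _ h

/-- `evol S0 t` is the state `S_t` reached after `t` steps from the initial state `S0`. -/
def evol (S0 : State G) (t : ℕ) : State G := (step G ord)^[t] S0

/-- `load S0 t d` is `L_t(d)`, the number of tokens sent along arc `d` during step `t`. -/
def load (S0 : State G) (t : ℕ) (d : G.Dart) : ℕ := arcLoad G ord (evol G ord S0 t) d

/-- `cum S0 t1 t2 d` is the cumulative load `C_{t1}^{t2}(d) = Σ_{t1 ≤ t < t2} L_t(d)`. -/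
def cum (S0 : State G) (t1 t2 : ℕ) (d : G.Dart) : ℕ :=
  ∑ t ∈ Finset.Ico t1 t2, load G ord S0 t d

/-- `cumV S0 t1 t2 v` is the cumulative vertex load `C_{t1}^{t2}(v)`. -/
def cumV (S0 : State G) (t1 t2 : ℕ) (v : V) : ℕ :=
  ∑ t ∈ Finset.Ico t1 t2, (evol G ord S0 t).tokens v

/-- `pot S0 i t` is the `i`-th potential `Φ_i(S_t) = Σ_{e} (C_t^{t+i}(e))²`. -/
def pot (S0 : State G) (i t : ℕ) : ℕ := ∑ d : G.Dart, (cum G ord S0 t (t + i) d) ^ 2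

/-- A state `S_t` is stable if it repeats: `S_{t'} = S_t` for some `t' > t`. -/
def IsStable (S0 : State G) (t : ℕ) : Prop :=
  ∃ t' > t, evol G ord S0 t' = evol G ord S0 t

/-- A family of bijections `in(v) → out(v)` (encoded as a global bijection `M` on darts
with `(M d).fst = d.snd`) is valid w.r.t. the `Δt`-step subcycle decomposition of `S_T`
if `L_t(e) = L_{t+1}(M e)` for all arcs `e` and all `T ≤ t < T + Δt`. -/
def ValidMapping (S0 : State G) (T Δt : ℕ) (M : G.Dart → G.Dart) : Prop :=
  Function.Bijective M ∧ (∀ d : G.Dart, (M d).fst = d.snd) ∧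
    ∀ (d : G.Dart) (t : ℕ), T ≤ t → t < T + Δt →
      load G ord S0 t d = load G ord S0 (t + 1) (M d)

/-- `S_T` admits a `Δt`-step subcycle decomposition. -/
def HasSubcycleDecomp (S0 : State G) (T Δt : ℕ) : Prop :=
  ∃ M : G.Dart → G.Dart, ValidMapping G ord S0 T Δt M


/-- A rotor-router system: a finite connected undirected graph together with a fixed
cyclic ordering of the outgoing arcs at every vertex. -/
structure System where
  V : Type
  [fin : Fintype V]
  [deq : DecidableEq V]
  G : SimpleGraph V
  [adj : DecidableRel G.Adj]
  conn : G.Connected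
  ord : ∀ v : V, Fin (G.degree v) ≃ {d : G.Dart // d.fst = v}

attribute [instance] System.fin System.deq System.adj

section Flow

variable {A B : Type}

/-- The total load `∑ L r e` over the times `s ≤ r < t`. -/
def window (L : ℕ → A → ℕ) (s t : ℕ) (e : A) : ℕ := ∑ r ∈ Ico s t, L r e

/-- Over the times `[s, t)`, the loads of any two arcs with the same endpoint `p` differ
by at most one. -/
def Balanced (L : ℕ → A → ℕ) (p : A → B) (s t : ℕ) : Prop :=
  ∀ e f, p e = p f → window L s t e ≤ window L s t f + 1

/-- The permutation `M` transports the loads of step `t` to those of step `t + 1`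
for all `s ≤ t < n`. -/
def Follows (L : ℕ → A → ℕ) (M : Equiv.Perm A) (s n : ℕ) : Prop :=
  ∀ e t, s ≤ t → t < n → L t e = L (t + 1) (M e)

lemma window_add_window (L : ℕ → A → ℕ) {r s t : ℕ} (h₁ : r ≤ s) (h₂ : s ≤ t) (e : A) :
    window L r s e + window L s t e = window L r t e :=
  sum_Ico_consecutive _ h₁ h₂

lemma window_succ_right (L : ℕ → A → ℕ) {s t : ℕ} (h : s ≤ t) (e : A) :
    window L s (t + 1) e = window L s t e + L t e :=
  sum_Ico_succ_top h _

lemma window_eq_window_add (L : ℕ → A → ℕ) {s t j : ℕ} {e f : A}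
    (h : ∀ r, s ≤ r → r < t → L r e = L (r + j) f) :
    window L s t e = window L (s + j) (t + j) f := by
  unfold window
  rw [← sum_Ico_add' (fun r => L r f)]
  exact sum_congr rfl fun r hr => h r (mem_Ico.1 hr).1 (mem_Ico.1 hr).2

namespace Follows

variable {L : ℕ → A → ℕ} {M : Equiv.Perm A} {s n : ℕ}

lemma window_eq (h : Follows L M s n) {r t : ℕ} (hr : s ≤ r) (ht : t ≤ n) (e : A) :
    window L r t e = window L (r + 1) (t + 1) (M e) :=
  window_eq_window_add L fun q h₁ h₂ => h e q (by omega) (by omega)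

lemma pow_apply (h : Follows L M s n) (e : A) {t : ℕ} (ht : s ≤ t) :
    ∀ {j : ℕ}, t + j ≤ n → L t e = L (t + j) ((M ^ j) e) := by
  intro j
  induction j with
  | zero => simp
  | succ j ih =>
    intro hj
    rw [ih (by omega), h _ (t + j) (by omega) (by omega), pow_succ', Equiv.Perm.mul_apply]
    rfl

lemma apply_add_period (h : Follows L M s n) {e : A} {p t : ℕ} (hp : (M ^ p) e = e)
    (ht : s ≤ t) (htn : t + p ≤ n) : L t e = L (t + p) e := by
  simpa [hp] using h.pow_apply e ht htn

lemma apply_add_mul_period (h : Follows L M s n) {e : A} {p t : ℕ} (hp : (M ^ p) e = e)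
    (q : ℕ) (ht : s ≤ t) (htn : t + p * q ≤ n) : L t e = L (t + p * q) e := by
  refine h.apply_add_period ?_ ht htn
  rw [pow_mul]
  exact Equiv.Perm.pow_apply_eq_self_of_apply_eq_self hp q

lemma balanced (h : Follows L M s n) {src tgt : A → B} (hM : ∀ e, src (M e) = tgt e)
    (hsrc : ∀ s t, Balanced L src s t) {r t : ℕ} (hr : s ≤ r) (ht : t ≤ n) :
    Balanced L tgt r t := by
  intro e f hef
  rw [h.window_eq hr ht, h.window_eq hr ht]
  exact hsrc _ _ _ _ (by rw [hM, hM, hef])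

end Follows

lemma exists_pow_apply_eq [Fintype A] (M : Equiv.Perm A) (e : A) :
    ∃ p, 0 < p ∧ p ≤ Fintype.card A ∧ (M ^ p) e = e := by
  classical
  refine ⟨Function.minimalPeriod M e, ?_, ?_, ?_⟩
  · exact Function.minimalPeriod_pos_of_mem_periodicPts
      (M.injective.mem_periodicPts e)
  · exact Function.minimalPeriod_le_card
  · rw [← Equiv.Perm.iterate_eq_pow]
    exact Function.iterate_minimalPeriod

/-- Among families of naturals with a given sum, the balanced ones minimise the sum of
squares. -/
lemma sum_sq_le_sum_sq_of_balanced {s : Finset A} {x y : A → ℕ}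
    (hy : ∀ e ∈ s, ∀ f ∈ s, y e ≤ y f + 1) (hsum : ∑ e ∈ s, x e = ∑ e ∈ s, y e) :
    ∑ e ∈ s, y e ^ 2 ≤ ∑ e ∈ s, x e ^ 2 ∧
      (∑ e ∈ s, y e ^ 2 = ∑ e ∈ s, x e ^ 2 → ∀ e ∈ s, ∀ f ∈ s, x e ≤ x f + 1) := by
  rcases s.eq_empty_or_nonempty with rfl | hs
  · simp
  obtain ⟨m, hm, hmin⟩ := exists_min_image s y hs
  obtain ⟨a, ha⟩ : ∃ a : ℤ, a = y m := ⟨_, rfl⟩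
  have hy0 : ∀ e ∈ s, ((y e : ℤ) - a) * (y e - a - 1) = 0 := by
    intro e he
    have h₁ := hmin e he
    have h₂ := hy e he m hm
    rcases (by omega : (y e : ℤ) - a = 0 ∨ (y e : ℤ) - a - 1 = 0) with h | h <;> simp [h]
  have hx0 : ∀ e ∈ s, 0 ≤ ((x e : ℤ) - a) * (x e - a - 1) := by
    intro e _
    rcases (by omega : (x e : ℤ) - a ≤ 0 ∨ 0 ≤ (x e : ℤ) - a - 1) with h | h
    · exact mul_nonneg_of_nonpos_of_nonpos h (by omega)
    · exact mul_nonneg (by omega) h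
  have hexp : ∀ z : A → ℕ, ∑ e ∈ s, ((z e : ℤ) - a) * (z e - a - 1) =
      ((∑ e ∈ s, z e ^ 2 : ℕ) : ℤ) - (2 * a + 1) * ((∑ e ∈ s, z e : ℕ) : ℤ) +
        #s * (a * (a + 1)) := by
    intro z
    push_cast
    rw [mul_sum, ← sum_sub_distrib, ← nsmul_eq_mul, ← sum_const, ← sum_add_distrib]
    exact sum_congr rfl fun e _ => by ring
  have hyz := (hexp y).symm.trans (sum_eq_zero hy0)
  have hxz := hexp x
  rw [hsum] at hxz
  refine ⟨?_, fun heq => ?_⟩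
  · have := sum_nonneg hx0
    zify
    push_cast at *
    linarith
  · have hzero : ∑ e ∈ s, ((x e : ℤ) - a) * (x e - a - 1) = 0 := by
      rw [hxz, ← heq, hyz]
    have hx1 := (sum_eq_zero_iff_of_nonneg hx0).1 hzero
    intro e he f hf
    rcases mul_eq_zero.1 (hx1 e he) with h₁ | h₁ <;>
      rcases mul_eq_zero.1 (hx1 f hf) with h₂ | h₂ <;> omega

/-- Two balanced families with equal sums over every fibre that do not coincide must
contain a pair of indices on which they are ordered in opposite ways. -/
lemma exists_opposite_pair [Fintype A] [DecidableEq B] {p : A → B} {x y : A → ℕ}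
    (hx : ∀ e f, p e = p f → x e ≤ x f + 1) (hy : ∀ e f, p e = p f → y e ≤ y f + 1)
    (hsum : ∀ v, ∑ e with p e = v, x e = ∑ e with p e = v, y e) (hne : x ≠ y) :
    ∃ e f, p e = p f ∧ x f = x e + 1 ∧ y e = y f + 1 ∧ x e = y f := by
  obtain ⟨g, hg⟩ := Function.ne_iff.1 hne
  have key : ∀ x y : A → ℕ, (∀ v, ∑ e with p e = v, x e = ∑ e with p e = v, y e) →
      x g ≠ y g → ∃ e, p e = p g ∧ x e < y e := by
    intro x y hs hg
    by_contra! hcon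
    have := (sum_eq_sum_iff_of_le (s := univ.filter fun e => p e = p g) (f := y) (g := x)
      fun e he => hcon e (by simpa using he)).1 (hs _).symm g (by simp)
    exact hg this.symm
  obtain ⟨e, he, hxe⟩ := key x y hsum hg
  obtain ⟨f, hf, hyf⟩ := key y x (fun v => (hsum v).symm) hg.symm
  have h₁ := hx f e (hf.trans he.symm)
  have h₂ := hy e f (he.trans hf.symm)
  exact ⟨e, f, he.trans hf.symm, by omega, by omega, by omega⟩

lemma sum_mul_swap [Fintype A] [DecidableEq A] (x y : A → ℤ) {e f : A} (hef : e ≠ f) :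
    ∑ g, x g * y (Equiv.swap e f g) =
      ∑ g, x g * y g + (x f - x e) * (y e - y f) := by
  have hf : f ∈ univ.erase e := by simp [hef.symm]
  rw [← add_sum_erase _ _ (mem_univ e), ← add_sum_erase _ _ hf,
    ← add_sum_erase _ (fun g => x g * y g) (mem_univ e), ← add_sum_erase _ _ hf]
  have : ∑ g ∈ (univ.erase e).erase f, x g * y (Equiv.swap e f g) =
      ∑ g ∈ (univ.erase e).erase f, x g * y g := by
    refine sum_congr rfl fun g hg => ?_
    simp only [mem_erase] at hg
    rw [Equiv.swap_apply_of_ne_of_ne hg.2.1 hg.1]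
  rw [this, Equiv.swap_apply_left, Equiv.swap_apply_right]
  ring

variable [Fintype A] [DecidableEq B] {L : ℕ → A → ℕ} {src tgt : A → B}

lemma sum_window_eq {M : Equiv.Perm A} (hM : ∀ e, src (M e) = tgt e)
    (hcons : ∀ t v, ∑ e with tgt e = v, L t e = ∑ e with src e = v, L (t + 1) e)
    (s t : ℕ) (v : B) :
    ∑ e with tgt e = v, window L s t e =
      ∑ e with tgt e = v, window L (s + 1) (t + 1) (M e) := by
  have h₁ : ∑ e with tgt e = v, window L (s + 1) (t + 1) (M e) =
      ∑ e with src e = v, window L (s + 1) (t + 1) e := by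
    refine sum_equiv M ?_ ?_
    · simp [hM]
    · simp
  rw [h₁]
  unfold window
  rw [sum_comm, sum_comm (s := univ.filter fun e => src e = v),
    ← sum_Ico_add' (fun r => ∑ e with src e = v, L r e)]
  exact sum_congr rfl fun r _ => hcons r v

/-- If the loads on incoming arcs are balanced on all subwindows of `[T, T + N)`, then some
permutation of the arcs transports loads throughout this window. -/
lemma exists_follows {M₀ : Equiv.Perm A} (hM₀ : ∀ e, src (M₀ e) = tgt e)
    (hcons : ∀ t v, ∑ e with tgt e = v, L t e = ∑ e with src e = v, L (t + 1) e)
    (hsrc : ∀ s t, Balanced L src s t) {T N : ℕ}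
    (htgt : ∀ s t, T ≤ s → s ≤ t → t ≤ T + N → Balanced L tgt s t) :
    ∃ M : Equiv.Perm A, (∀ e, src (M e) = tgt e) ∧ Follows L M T (T + N) := by
  classical
  obtain ⟨M, hM, hmax⟩ := exists_max_image
    (univ.filter fun M : Equiv.Perm A => ∀ e, src (M e) = tgt e)
    (fun M => ∑ s ∈ range (N + 1), ∑ e,
      (window L T (T + s) e : ℤ) * window L (T + 1) (T + s + 1) (M e)) ⟨M₀, by simpa using hM₀⟩
  simp only [mem_filter, mem_univ, true_and] at hM hmax
  refine ⟨M, hM, ?_⟩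
  have key : ∀ s ≤ N, ∀ e, window L T (T + s) e = window L (T + 1) (T + s + 1) (M e) := by
    by_contra! hcon
    obtain ⟨s, hs, hne⟩ := hcon
    obtain ⟨e, f, hef, hx, hy, -⟩ := exists_opposite_pair (p := tgt)
      (x := window L T (T + s)) (y := fun e => window L (T + 1) (T + s + 1) (M e))
      (htgt _ _ le_rfl (by omega) (by omega))
      (fun e f h => hsrc _ _ _ _ (by rw [hM, hM, h]))
      (sum_window_eq hM hcons _ _) (Function.ne_iff.2 hne)
    have hne' : e ≠ f := by rintro rfl; omega
    have hmono : ∀ r ≤ N, window L T (T + r) e ≤ window L T (T + r) f := by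
      intro r hr
      rcases le_total r s with h | h
      · have h₁ := window_add_window L (show T ≤ T + r by omega) (show T + r ≤ T + s by omega) e
        have h₂ := window_add_window L (show T ≤ T + r by omega) (show T + r ≤ T + s by omega) f
        have h₃ := htgt (T + r) (T + s) (by omega) (by omega) (by omega) f e hef.symm
        omega
      · have h₁ := window_add_window L (show T ≤ T + s by omega) (show T + s ≤ T + r by omega) e
        have h₂ := window_add_window L (show T ≤ T + s by omega) (show T + s ≤ T + r by omega) f
        have h₃ := htgt (T + s) (T + r) (by omega) (by omega) (by omega) e f hef
        omega
    have hmono' : ∀ r, window L (T + 1) (T + r + 1) (M f) ≤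
        window L (T + 1) (T + r + 1) (M e) := by
      intro r
      have hMef : src (M e) = src (M f) := by rw [hM, hM, hef]
      rcases le_total r s with h | h
      · have h₁ := window_add_window L (show T + 1 ≤ T + r + 1 by omega)
          (show T + r + 1 ≤ T + s + 1 by omega) (M e)
        have h₂ := window_add_window L (show T + 1 ≤ T + r + 1 by omega)
          (show T + r + 1 ≤ T + s + 1 by omega) (M f)
        have h₃ := hsrc (T + r + 1) (T + s + 1) _ _ hMef
        omega
      · have h₁ := window_add_window L (show T + 1 ≤ T + s + 1 by omega)
          (show T + s + 1 ≤ T + r + 1 by omega) (M e)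
        have h₂ := window_add_window L (show T + 1 ≤ T + s + 1 by omega)
          (show T + s + 1 ≤ T + r + 1 by omega) (M f)
        have h₃ := hsrc (T + s + 1) (T + r + 1) _ _ hMef.symm
        omega
    refine (hmax (M * Equiv.swap e f) fun g => ?_).not_gt ?_
    · rw [Equiv.Perm.mul_apply, hM]
      by_cases h₁ : g = e
      · simp [h₁, hef]
      by_cases h₂ : g = f
      · simp [h₂, hef]
      rw [Equiv.swap_apply_of_ne_of_ne h₁ h₂]
    · have hswap := fun r => sum_mul_swap (fun g => (window L T (T + r) g : ℤ))
        (fun g => (window L (T + 1) (T + r + 1) (M g) : ℤ)) hne'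
      simp only [Equiv.Perm.mul_apply, hswap]
      refine sum_lt_sum (fun r hr => ?_) ⟨s, by simp; omega, ?_⟩
      · have h₁ := hmono r (by simp at hr; omega)
        have h₂ := hmono' r
        have : (0 : ℤ) ≤ ((window L T (T + r) f : ℤ) - window L T (T + r) e) *
            ((window L (T + 1) (T + r + 1) (M e) : ℤ) - window L (T + 1) (T + r + 1) (M f)) :=
          mul_nonneg (by omega) (by omega)
        linarith
      · rw [hx, hy]
        push_cast
        linarith
  intro e t ht htN
  obtain ⟨s, rfl⟩ := Nat.exists_eq_add_of_le ht
  have h₁ := key s (by omega) e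
  have h₂ := key (s + 1) (by omega) e
  rw [← add_assoc, window_succ_right L (by omega), window_succ_right L (by omega)] at h₂
  omega

/-- A transporting permutation on a window of length at least twice the number of arcs
remains valid for one more step, as long as the loads on incoming arcs remain balanced. -/
lemma Follows.succ {M : Equiv.Perm A} (hM : ∀ e, src (M e) = tgt e)
    (hcons : ∀ t v, ∑ e with tgt e = v, L t e = ∑ e with src e = v, L (t + 1) e)
    (hsrc : ∀ s t, Balanced L src s t) {T n : ℕ} (hn : T + 2 * Fintype.card A ≤ n)
    (h : Follows L M T n)
    (htgt : ∀ s, n ≤ s + 2 * Fintype.card A → s ≤ n + 1 → Balanced L tgt s (n + 1)) :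
    Follows L M T (n + 1) := by
  obtain ⟨a, ha⟩ : ∃ a, a + 2 * Fintype.card A = n :=
    ⟨n - 2 * Fintype.card A, by omega⟩
  have key : window L a (n + 1) = fun e => window L (a + 1) (n + 1 + 1) (M e) := by
    by_contra hne
    obtain ⟨e, f, hef, hx, hy, -⟩ := exists_opposite_pair (p := tgt)
      (htgt _ (by omega) (by omega))
      (fun e f h => hsrc (a + 1) (n + 1 + 1) _ _ (by rw [hM, hM, h]))
      (sum_window_eq hM hcons _ _) hne
    have hMef : src (M e) = src (M f) := by rw [hM, hM, hef]
    have heq : ∀ r, a ≤ r → r ≤ n → window L a r e = window L a r f := by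
      intro r har hrn
      have h₁ := window_add_window L har (show r ≤ n + 1 by omega) e
      have h₂ := window_add_window L har (show r ≤ n + 1 by omega) f
      have h₃ := htgt r (by omega) (by omega) f e hef.symm
      have h₄ := window_add_window L (show a + 1 ≤ r + 1 by omega)
        (show r + 1 ≤ n + 1 + 1 by omega) (M e)
      have h₅ := window_add_window L (show a + 1 ≤ r + 1 by omega)
        (show r + 1 ≤ n + 1 + 1 by omega) (M f)
      have h₆ := hsrc (r + 1) (n + 1 + 1) _ _ hMef
      have h₇ := h.window_eq (show T ≤ a by omega) hrn e
      have h₈ := h.window_eq (show T ≤ a by omega) hrn f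
      omega
    have hload : ∀ r, a ≤ r → r < n → L r e = L r f := by
      intro r har hrn
      have h₁ := heq r har hrn.le
      have h₂ := heq (r + 1) (by omega) hrn
      rw [window_succ_right L har, window_succ_right L har] at h₂
      omega
    have hlast : L n e = L n f := by
      obtain ⟨p, hp₀, hp, hpe⟩ := exists_pow_apply_eq M e
      obtain ⟨q, hq₀, hq, hqf⟩ := exists_pow_apply_eq M f
      have e₁ := h.apply_add_period (t := n - p) hpe (by omega) (by omega)
      have e₂ := h.apply_add_period (t := n - p - q) hqf (by omega) (by omega)
      have e₃ := h.apply_add_period (t := n - p - q) hpe (by omega) (by omega)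
      have e₄ := h.apply_add_period (t := n - q) hqf (by omega) (by omega)
      have l₁ := hload (n - p) (by omega) (by omega)
      have l₂ := hload (n - p - q) (by omega) (by omega)
      have l₃ := hload (n - q) (by omega) (by omega)
      rw [show n - p + p = n by omega] at e₁
      rw [show n - p - q + q = n - p by omega] at e₂
      rw [show n - p - q + p = n - q by omega] at e₃
      rw [show n - q + q = n by omega] at e₄
      omega
    rw [window_succ_right L (by omega), window_succ_right L (by omega), hlast,
      heq n (by omega) le_rfl] at hx
    omega
  intro e t ht htn
  rcases Nat.lt_succ_iff_lt_or_eq.1 htn with hlt | rfl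
  · exact h e t ht hlt
  · have h₁ := congrFun key e
    have h₂ := h.window_eq (show T ≤ a by omega) le_rfl e
    simp only [window_succ_right L (show a ≤ t by omega),
      window_succ_right L (show a + 1 ≤ t + 1 by omega)] at h₁
    omega

/-- If incoming loads are balanced on all short subwindows of a window of quadratic length,
then the loads are periodic from the start of that window. -/
lemma exists_period_of_balanced {M₀ : Equiv.Perm A} (hM₀ : ∀ e, src (M₀ e) = tgt e)
    (hcons : ∀ t v, ∑ e with tgt e = v, L t e = ∑ e with src e = v, L (t + 1) e)
    (hsrc : ∀ s t, Balanced L src s t) {T : ℕ}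
    (htgt : ∀ s t, T ≤ s → s ≤ T + (Fintype.card A + 1) ^ 2 → s ≤ t →
      t ≤ s + (2 * Fintype.card A + 1) → Balanced L tgt s t) :
    ∃ P, 0 < P ∧ ∀ t, T ≤ t → ∀ e, L (t + P) e = L t e := by
  classical
  set K := Fintype.card A with hK
  obtain ⟨M, hM, hbase⟩ := exists_follows (T := T) (N := 2 * K) hM₀ hcons hsrc
    (fun s t h₁ h₂ h₃ => htgt s t h₁ (by nlinarith) h₂ (by omega))
  have hall : ∀ j, Follows L M T (T + 2 * K + j) := by
    intro j
    induction j with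
    | zero => exact hbase
    | succ j ih =>
      rw [← add_assoc]
      refine ih.succ hM hcons hsrc (by omega) fun s hs₁ hs₂ => ?_
      rw [← hK] at hs₁
      by_cases hj : s ≤ T + (K + 1) ^ 2
      · exact htgt s _ (by omega) hj hs₂ (by omega)
      · intro e f hef
        obtain ⟨p, hp₀, hp, hpe⟩ := exists_pow_apply_eq M e
        obtain ⟨q, hq₀, hq, hqf⟩ := exists_pow_apply_eq M f
        have hpq : p * q ≤ K * K := Nat.mul_le_mul hp hq
        have hpq₀ : 0 < p * q := Nat.mul_pos hp₀ hq₀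
        have hs : T + p * q ≤ s := by nlinarith
        have hb := ih.balanced hM hsrc (r := s - p * q) (t := T + 2 * K + j + 1 - p * q)
          (by omega) (by omega) e f hef
        rw [window_eq_window_add L (j := p * q) (f := e), window_eq_window_add L (j := p * q)
          (e := f) (f := f)] at hb
        · rwa [show s - p * q + p * q = s by omega,
            show T + 2 * K + j + 1 - p * q + p * q = T + 2 * K + j + 1 by omega] at hb
        · intro r h₁ h₂
          rw [mul_comm]
          exact ih.apply_add_mul_period hqf _ (by omega) (by rw [mul_comm]; omega)
        · intro r h₁ h₂
          exact ih.apply_add_mul_period hpe _ (by omega) (by omega)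
  refine ⟨orderOf M, orderOf_pos M, fun t ht e => ?_⟩
  refine ((hall (t + orderOf M)).apply_add_period ?_ ht (by omega)).symm
  simp [pow_orderOf_eq_one]

lemma sum_window_sq_succ_le [Fintype B] {M : Equiv.Perm A} (hM : ∀ e, src (M e) = tgt e)
    (hcons : ∀ t v, ∑ e with tgt e = v, L t e = ∑ e with src e = v, L (t + 1) e)
    (hsrc : ∀ s t, Balanced L src s t) (s t : ℕ) :
    ∑ e, window L (s + 1) (t + 1) e ^ 2 ≤ ∑ e, window L s t e ^ 2 ∧
      (∑ e, window L (s + 1) (t + 1) e ^ 2 = ∑ e, window L s t e ^ 2 → Balanced L tgt s t) := by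
  have hfib := fun v : B => sum_sq_le_sum_sq_of_balanced (s := univ.filter fun e => tgt e = v)
    (x := window L s t) (y := fun e => window L (s + 1) (t + 1) (M e))
    (fun e he f hf => hsrc _ _ _ _ (by simp_all)) (sum_window_eq hM hcons s t v)
  rw [← Equiv.sum_comp M, ← sum_fiberwise univ tgt,
    ← sum_fiberwise univ tgt (fun e => window L s t e ^ 2)]
  refine ⟨sum_le_sum fun v _ => (hfib v).1, fun heq e f hef => ?_⟩
  have := (sum_eq_sum_iff_of_le fun v _ => (hfib v).1).1 heq (tgt f) (mem_univ _)
  exact (hfib _).2 this e (by simpa using hef) f (by simp)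

lemma exists_plateau {f : ℕ → ℕ} (hf : Antitone f) (w : ℕ) :
    ∃ j ≤ f 0, f (w * (j + 1)) = f (w * j) := by
  by_contra! hcon
  have : ∀ j ≤ f 0 + 1, f (w * j) + j ≤ f 0 := by
    intro j
    induction j with
    | zero => simp
    | succ j ih =>
      intro hj
      have h₁ := ih (by omega)
      have h₂ := hf (show w * j ≤ w * (j + 1) by gcongr; omega)
      have h₃ := hcon j (by omega)
      omega
  have := this _ le_rfl
  omega

/-- A flow of total volume `k` with balanced outgoing loads becomes periodic within a
polynomial number of steps. -/
lemma exists_period [Fintype B] {M : Equiv.Perm A} (hM : ∀ e, src (M e) = tgt e)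
    (hcons : ∀ t v, ∑ e with tgt e = v, L t e = ∑ e with src e = v, L (t + 1) e)
    (hsrc : ∀ s t, Balanced L src s t) {k : ℕ} (hk : ∀ t, ∑ e, L t e = k) :
    ∃ T ≤ ((Fintype.card A + 1) ^ 2 + 1) *
        ((2 * Fintype.card A + 2) * ((2 * Fintype.card A + 1) * k) ^ 2),
      ∃ P, 0 < P ∧ ∀ t, T ≤ t → ∀ e, L (t + P) e = L t e := by
  set K := Fintype.card A with hK
  let F : ℕ → ℕ := fun t => ∑ i ∈ range (2 * K + 2), ∑ e, window L t (t + i) e ^ 2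
  have hle : ∀ t i, ∑ e, window L (t + 1) (t + 1 + i) e ^ 2 ≤ ∑ e, window L t (t + i) e ^ 2 := by
    intro t i
    rw [add_right_comm]
    exact (sum_window_sq_succ_le hM hcons hsrc t (t + i)).1
  have hF : Antitone F := antitone_nat_of_succ_le fun t => sum_le_sum fun i _ => hle t i
  have hF0 : F 0 ≤ (2 * K + 2) * ((2 * K + 1) * k) ^ 2 := by
    have : ∀ i ∈ range (2 * K + 2), ∑ e, window L 0 (0 + i) e ^ 2 ≤ ((2 * K + 1) * k) ^ 2 := by
      intro i hi
      have hi : i ≤ 2 * K + 1 := by simp at hi; omega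
      have hsum : ∑ e, window L 0 (0 + i) e = i * k := by
        unfold window
        rw [sum_comm]
        simp [hk]
      calc ∑ e, window L 0 (0 + i) e ^ 2 ≤ (∑ e, window L 0 (0 + i) e) ^ 2 :=
            sum_sq_le_sq_sum_of_nonneg fun _ _ => Nat.zero_le _
        _ ≤ ((2 * K + 1) * k) ^ 2 := by rw [hsum]; gcongr
    simpa [F] using sum_le_sum this
  obtain ⟨j, hj, hplat⟩ := exists_plateau hF ((K + 1) ^ 2 + 1)
  refine ⟨((K + 1) ^ 2 + 1) * j, Nat.mul_le_mul_left _ (hj.trans hF0),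
    exists_period_of_balanced hM hcons hsrc fun s t h₁ h₂ h₃ h₄ => ?_⟩
  rw [← hK] at h₂ h₄
  have hs : F (s + 1) = F s := by
    have e₁ := hF h₁
    have e₂ := hF (show s + 1 ≤ ((K + 1) ^ 2 + 1) * (j + 1) by rw [mul_add]; omega)
    have e₃ := hF (Nat.le_add_right s 1)
    omega
  have := (sum_eq_sum_iff_of_le fun i _ => hle s i).1 hs (t - s) (by simp; omega)
  rw [add_right_comm, show s + (t - s) = t by omega] at this
  exact (sum_window_sq_succ_le hM hcons hsrc s t).2 this

end Flow

lemma sentCount_eq_count (deg p k j : ℕ) :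
    sentCount deg p k j = Nat.count (fun i => (p + i) % deg = j) k := by
  rw [sentCount, Nat.count_eq_card_filter_range]

lemma sentCount_add (deg p a b j : ℕ) :
    sentCount deg p (a + b) j = sentCount deg p a j + sentCount deg ((p + a) % deg) b j := by
  simp only [sentCount_eq_count, Nat.count_add, Nat.mod_add_mod, add_assoc]

lemma sentCount_le_add_one {deg j j' : ℕ} (p k : ℕ) (hj : j < deg) (hj' : j' < deg) :
    sentCount deg p k j ≤ sentCount deg p k j' + 1 := by
  have key : ∀ j < deg, ∃ v, sentCount deg p k j = Nat.count (· ≡ v [MOD deg]) k := by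
    intro j hj
    refine ⟨j + deg - p % deg, ?_⟩
    rw [sentCount_eq_count]
    congr 1
    ext i
    have hp : p % deg < deg := Nat.mod_lt _ (by omega)
    have h₁ : (p + (j + deg - p % deg)) % deg = j := by
      rw [← Nat.mod_add_mod, show p % deg + (j + deg - p % deg) = j + deg by omega,
        Nat.add_mod_right, Nat.mod_eq_of_lt hj]
    constructor
    · intro h
      exact Nat.ModEq.add_left_cancel' p (h.trans h₁.symm)
    · intro h
      exact Eq.trans (Nat.ModEq.add_left p h) h₁
  obtain ⟨v, hv⟩ := key j hj
  obtain ⟨w, hw⟩ := key j' hj'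
  have hdeg : 0 < deg := by omega
  rw [hv, hw, Nat.count_modEq_card _ hdeg, Nat.count_modEq_card _ hdeg]
  split_ifs <;> omega

lemma sum_sentCount {deg : ℕ} (hdeg : 0 < deg) (p k : ℕ) :
    ∑ j : Fin deg, sentCount deg p k j = k := by
  rw [Fin.sum_univ_eq_sum_range (fun j => sentCount deg p k j)]
  unfold sentCount
  rw [← card_eq_sum_card_fiberwise (f := fun i => (p + i) % deg)]
  · simp
  · intro i _
    simpa using Nat.mod_lt _ hdeg

section Dynamics

variable {G ord}

lemma evol_succ (S : State G) (t : ℕ) : evol G ord S (t + 1) = step G ord (evol G ord S t) :=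
  Function.iterate_succ_apply' _ _ _

lemma ptr_evol_succ (hdeg : ∀ v, 0 < G.degree v) (S : State G) (t : ℕ) (v : V) :
    (evol G ord S (t + 1)).ptr v =
      ((evol G ord S t).ptr v + (evol G ord S t).tokens v) % G.degree v := by
  rw [evol_succ]
  simp [step, hdeg v]

lemma cumV_succ_right (S : State G) {s t : ℕ} (h : s ≤ t) (v : V) :
    cumV G ord S s (t + 1) v = cumV G ord S s t v + (evol G ord S t).tokens v :=
  sum_Ico_succ_top h _

lemma ptr_evol_eq (hdeg : ∀ v, 0 < G.degree v) (S : State G) {s t : ℕ} (h : s ≤ t) (v : V) :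
    (evol G ord S t).ptr v =
      ((evol G ord S s).ptr v + cumV G ord S s t v) % G.degree v := by
  induction t, h using Nat.le_induction with
  | base => simp [cumV, Nat.mod_eq_of_lt ((evol G ord S s).ptr_lt v (hdeg v))]
  | succ t hst ih =>
    rw [ptr_evol_succ hdeg, ih, cumV_succ_right S hst, Nat.mod_add_mod, add_assoc]

lemma window_load_eq (hdeg : ∀ v, 0 < G.degree v) (S : State G) {s t : ℕ} (h : s ≤ t)
    (d : G.Dart) :
    window (load G ord S) s t d =
      sentCount (G.degree d.fst) ((evol G ord S s).ptr d.fst) (cumV G ord S s t d.fst)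
        ((ord d.fst).symm ⟨d, rfl⟩ : Fin (G.degree d.fst)) := by
  induction t, h using Nat.le_induction with
  | base => simp [window, cumV, sentCount]
  | succ t hst ih =>
    rw [window_succ_right _ hst, ih, cumV_succ_right S hst, sentCount_add,
      ← ptr_evol_eq hdeg S hst]
    rfl

lemma balanced_load (hdeg : ∀ v, 0 < G.degree v) (S : State G) (s t : ℕ) :
    Balanced (load G ord S) (fun d : G.Dart => d.fst) s t := by
  intro d d' hdd
  rcases le_total s t with h | h
  · rw [window_load_eq hdeg S h, window_load_eq hdeg S h]
    dsimp only at hdd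
    have hlt := ((ord d'.fst).symm ⟨d', rfl⟩).isLt
    generalize (((ord d'.fst).symm ⟨d', rfl⟩ : Fin (G.degree d'.fst)) : ℕ) = j' at hlt ⊢
    rw [← hdd] at hlt ⊢
    exact sentCount_le_add_one _ _ (Fin.isLt _) hlt
  · simp [window, Ico_eq_empty_of_le h]

lemma sum_load_fst (hdeg : ∀ v, 0 < G.degree v) (S : State G) (t : ℕ) (v : V) :
    ∑ d : G.Dart with d.fst = v, load G ord S t d = (evol G ord S t).tokens v := by
  rw [← sum_sentCount (hdeg v) ((evol G ord S t).ptr v) ((evol G ord S t).tokens v),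
    ← Equiv.sum_comp (ord v).symm,
    sum_subtype (p := fun d : G.Dart => d.fst = v) _ (by simp)]
  refine sum_congr rfl fun d _ => ?_
  obtain ⟨d, rfl⟩ := d
  rfl

lemma sum_load_snd (hdeg : ∀ v, 0 < G.degree v) (S : State G) (t : ℕ) (v : V) :
    ∑ d : G.Dart with d.snd = v, load G ord S t d = (evol G ord S (t + 1)).tokens v := by
  rw [evol_succ]
  simp [step, hdeg v, inArcs, load]

lemma sum_load (hdeg : ∀ v, 0 < G.degree v) (S : State G) (t : ℕ) :
    ∑ d, load G ord S t d = ∑ v, S.tokens v := by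
  have h : ∀ t, ∑ d, load G ord S t d = ∑ v, (evol G ord S t).tokens v := fun t => by
    rw [← sum_fiberwise univ (fun d : G.Dart => d.fst)]
    exact sum_congr rfl fun v _ => sum_load_fst hdeg S t v
  induction t with
  | zero => exact h 0
  | succ t ih =>
    rw [h, ← ih, ← sum_fiberwise univ (fun d : G.Dart => d.snd)]
    exact sum_congr rfl fun v _ => (sum_load_snd hdeg S t v).symm

lemma isStable_of_load_periodic (hdeg : ∀ v, 0 < G.degree v) (S : State G) {T P : ℕ}
    (hP : 0 < P) (hper : ∀ t, T ≤ t → ∀ d, load G ord S (t + P) d = load G ord S t d) :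
    IsStable G ord S T := by
  have htok : ∀ t, T ≤ t → ∀ v,
      (evol G ord S (t + P)).tokens v = (evol G ord S t).tokens v := fun t ht v => by
    rw [← sum_load_fst hdeg, ← sum_load_fst hdeg]
    exact sum_congr rfl fun d _ => hper t ht d
  have htok' : ∀ q v, (evol G ord S (T + P * q)).tokens v = (evol G ord S T).tokens v := by
    intro q v
    induction q with
    | zero => rfl
    | succ q ih => rw [mul_add, mul_one, ← add_assoc, htok _ (by omega), ih]
  have hcum : ∀ q v, cumV G ord S T (T + P * q) v = q * cumV G ord S T (T + P) v := by
    intro q v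
    induction q with
    | zero => simp [cumV]
    | succ q ih =>
      have hshift : cumV G ord S (T + P * 1) (T + P * (q + 1)) v =
          cumV G ord S T (T + P * q) v := by
        unfold cumV
        rw [show T + P * (q + 1) = T + P * q + P by ring, mul_one,
          ← sum_Ico_add' (fun t => (evol G ord S t).tokens v)]
        exact sum_congr rfl fun t ht => htok t (mem_Ico.1 ht).1 v
      have hsplit : cumV G ord S T (T + P * (q + 1)) v =
          cumV G ord S T (T + P * 1) v + cumV G ord S (T + P * 1) (T + P * (q + 1)) v :=
        (sum_Ico_consecutive _ (by omega) (by gcongr; omega)).symm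
      rw [hsplit, hshift, ih, mul_one]
      ring
  have hQ : 0 < ∏ v, G.degree v := prod_pos fun v _ => hdeg v
  refine ⟨T + P * ∏ v, G.degree v, by have := Nat.mul_pos hP hQ; omega, ?_⟩
  have hptr : ∀ v, (evol G ord S (T + P * ∏ v, G.degree v)).ptr v = (evol G ord S T).ptr v := by
    intro v
    rw [ptr_evol_eq hdeg S (Nat.le_add_right T _), hcum]
    obtain ⟨c, hc⟩ := dvd_prod_of_mem (fun v => G.degree v) (mem_univ v)
    rw [hc, mul_assoc, Nat.add_mul_mod_self_left,
      Nat.mod_eq_of_lt ((evol G ord S T).ptr_lt v (hdeg v))]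
  have hext : ∀ S₁ S₂ : State G, S₁.ptr = S₂.ptr → S₁.tokens = S₂.tokens → S₁ = S₂ := by
    rintro ⟨⟩ ⟨⟩ h₁ h₂
    simp_all
  exact hext _ _ (funext hptr) (funext (htok' _))

lemma isStable_zero_of_degree_eq_zero (hdeg : ∀ v, G.degree v = 0) (S : State G) :
    IsStable G ord S 0 := by
  refine ⟨1, one_pos, ?_⟩
  have hno : ∀ v, inArcs G v = ∅ := fun v => by
    refine eq_empty_of_forall_notMem fun d _ => ?_
    have := (G.degree_pos_iff_exists_adj d.fst).2 ⟨d.snd, d.adj⟩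
    simp [hdeg] at this
  rw [evol_succ]
  simp [evol, step, hdeg, hno]

end Dynamics

/-- There is a constant `C > 0` such that every rotor-router system on a
finite connected graph with `m` edges, carrying `k ≥ 1` tokens, reaches a stable state
within `C·m⁵·k²` steps. -/
theorem stabilization_time_m5k2 :
    ∃ C : ℕ, 0 < C ∧
      ∀ (sys : System) (S0 : State sys.G),
        1 ≤ ∑ v : sys.V, S0.tokens v →
        ∃ T : ℕ,
          T ≤ C * sys.G.edgeFinset.card ^ 5 * (∑ v : sys.V, S0.tokens v) ^ 2 ∧
          IsStable sys.G sys.ord S0 T := by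
  refine ⟨10000, by norm_num, fun sys S0 _ => ?_⟩
  set m := #sys.G.edgeFinset with hm
  set k := ∑ v, S0.tokens v with hk
  rcases subsingleton_or_nontrivial sys.V with hV | hV
  · refine ⟨0, Nat.zero_le _, isStable_zero_of_degree_eq_zero (fun v => ?_) S0⟩
    exact sys.G.degree_eq_zero_of_subsingleton v
  have hdeg : ∀ v, 0 < sys.G.degree v := fun v =>
    sys.conn.preconnected.degree_pos_of_nontrivial v
  have hcard : Fintype.card sys.G.Dart = 2 * m := sys.G.dart_card_eq_twice_card_edges
  have hm1 : 1 ≤ m := by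
    obtain ⟨v⟩ := sys.conn.nonempty
    obtain ⟨w, hw⟩ := (sys.G.degree_pos_iff_exists_adj v).1 (hdeg v)
    have : 0 < Fintype.card sys.G.Dart := Fintype.card_pos_iff.2 ⟨⟨(v, w), hw⟩⟩
    omega
  obtain ⟨T, hT, P, hP, hper⟩ := exists_period (L := load sys.G sys.ord S0)
    (src := fun d => d.fst) (tgt := fun d => d.snd)
    (M := Function.Involutive.toPerm _ SimpleGraph.Dart.symm_involutive) (fun _ => rfl)
    (fun t v => (sum_load_snd hdeg S0 t v).trans (sum_load_fst hdeg S0 (t + 1) v).symm)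
    (balanced_load hdeg S0) (sum_load hdeg S0)
  refine ⟨T, hT.trans ?_, isStable_of_load_periodic hdeg S0 hP hper⟩
  rw [hcard, ← hk]
  calc ((2 * m + 1) ^ 2 + 1) * ((2 * (2 * m) + 2) * ((2 * (2 * m) + 1) * k) ^ 2)
      ≤ ((3 * m) ^ 2 + m ^ 2) * ((6 * m) * ((5 * m) * k) ^ 2) := by
        gcongr
        · omega
        · exact Nat.one_le_pow _ _ hm1
        · omega
        · omega
    _ = 1500 * (m ^ 5 * k ^ 2) := by ring
    _ ≤ 10000 * m ^ 5 * k ^ 2 := by rw [mul_assoc]; gcongr; norm_num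

end RotorRouter
end

section
/- For any round-fair token distribution process W on a finite connected undirected graph, the discrepancy over arcs is non-increasing in time: max_{e,e' ∈ E⃗} (W_t(e) − W_t(e')) ≥ max_{e,e' ∈ E⃗} (W_{t+1}(e) − W_{t+1}(e')). -/
open Finset

namespace RotorRouter

variable {V : Type} [Fintype V] [DecidableEq V] (G : SimpleGraph V) [DecidableRel G.Adj]

variable (ord : ∀ v : V, Fin (G.degree v) ≃ {d : G.Dart // d.fst = v})

/-- A round-fair token distribution process on `G`: loads `wv t v` on vertices and
`we t d` on arcs such that each vertex distributes its load almost evenly (floor or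
ceiling of the average) among its outgoing arcs, sends out all of its load, and
receives in the next step the loads of its incoming arcs. -/
structure RoundFairProcess where
  wv : ℕ → V → ℕ
  we : ℕ → G.Dart → ℕ
  fair : ∀ (t : ℕ) (d : G.Dart),
    we t d = wv t d.fst / G.degree d.fst ∨
      we t d = (wv t d.fst + G.degree d.fst - 1) / G.degree d.fst
  sum_out : ∀ (t : ℕ) (v : V), wv t v = ∑ d ∈ outArcs G v, we t d
  recv : ∀ (t : ℕ) (v : V), wv (t + 1) v = ∑ d ∈ inArcs G v, we t d

/-- The discrepancy over arcs of the process at time `t`: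
`max_{e,e' ∈ E⃗} (W_t(e) − W_t(e'))`. -/
def disc (W : RoundFairProcess G) (t : ℕ) : ℕ :=
  Finset.univ.sup fun p : G.Dart × G.Dart => W.we t p.1 - W.we t p.2

/-- The potential `Φ(W_t) = Σ_{e ∈ E⃗} (W_t(e))²` of the process at time `t`. -/
def rfPot (W : RoundFairProcess G) (t : ℕ) : ℕ := ∑ d : G.Dart, W.we t d ^ 2

theorem card_inArcs (v : V) : (inArcs G v).card = G.degree v := by
  rw [← G.dart_fst_fiber_card_eq_degree v]
  refine Finset.card_bij (fun d _ => d.symm) ?_ ?_ ?_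
  · intro d hd
    simpa [inArcs] using hd
  · intro d _ d' _ h
    exact SimpleGraph.Dart.symm_involutive.injective h
  · intro d hd
    exact ⟨d.symm, by simpa [inArcs] using hd, d.symm_symm⟩

/-- Some arc carries at time `t` at least the load of `d` at time `t + 1`. -/
theorem exists_load_ge (W : RoundFairProcess G) (t : ℕ) (d : G.Dart) :
    ∃ e : G.Dart, W.we (t + 1) d ≤ W.we t e := by
  by_contra! h
  have hpos : 0 < G.degree d.fst :=
    (G.degree_pos_iff_exists_adj d.fst).2 ⟨d.snd, d.adj⟩
  have ha : 0 < W.we (t + 1) d := (Nat.zero_le _).trans_lt (h d)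
  have hsum : W.wv (t + 1) d.fst ≤ G.degree d.fst * (W.we (t + 1) d - 1) := by
    rw [W.recv, ← card_inArcs, ← smul_eq_mul]
    exact Finset.sum_le_card_nsmul _ _ _ fun e _ => Nat.le_sub_one_of_lt (h e)
  have hlt : W.we (t + 1) d < W.we (t + 1) d - 1 + 1 := by
    rcases W.fair (t + 1) d with hf | hf
    all_goals
      nth_rw 1 [hf]
      rw [Nat.div_lt_iff_lt_mul hpos, add_mul, one_mul, mul_comm]
      omega
  omega

/-- Some arc carries at time `t` at most the load of `d` at time `t + 1`. -/
theorem exists_load_le (W : RoundFairProcess G) (t : ℕ) (d : G.Dart) :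
    ∃ e : G.Dart, W.we t e ≤ W.we (t + 1) d := by
  by_contra! h
  have hpos : 0 < G.degree d.fst :=
    (G.degree_pos_iff_exists_adj d.fst).2 ⟨d.snd, d.adj⟩
  have hsum : G.degree d.fst * (W.we (t + 1) d + 1) ≤ W.wv (t + 1) d.fst := by
    rw [W.recv, ← card_inArcs, ← smul_eq_mul]
    exact Finset.card_nsmul_le_sum _ _ _ fun e _ => h e
  have hle : W.we (t + 1) d + 1 ≤ W.we (t + 1) d := by
    rcases W.fair (t + 1) d with hf | hf
    all_goals
      nth_rw 2 [hf]
      rw [Nat.le_div_iff_mul_le hpos, mul_comm]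
      omega
  omega

/-- For any round-fair token distribution process on a finite connected
graph, the discrepancy over arcs is non-increasing in time. -/
theorem discrepancy_nonincreasing (hconn : G.Connected) (W : RoundFairProcess G) (t : ℕ) :
    disc G W (t + 1) ≤ disc G W t := by
  refine Finset.sup_le fun p _ => ?_
  obtain ⟨e, he⟩ := exists_load_ge G W t p.1
  obtain ⟨e', he'⟩ := exists_load_le G W t p.2
  exact (tsub_le_tsub he he').trans
    (Finset.le_sup (f := fun p : G.Dart × G.Dart => W.we t p.1 - W.we t p.2)
      (Finset.mem_univ (e, e')))

end RotorRouter
end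

section
/- Let W be a round-fair token distribution process on a finite connected non-bipartite undirected graph G with diameter D, and suppose that at time t the discrepancy over arcs x = max_{e,e' ∈ E⃗} (W_t(e) − W_t(e')) satisfies x > 4D + 1. Then the potential drops by at least Φ(W_t) − Φ(W_{t+1}) ≥ (x − 4D − 1)(x − 1)/(4D). -/
open Finset

namespace RotorRouter

variable {V : Type} [Fintype V] [DecidableEq V] (G : SimpleGraph V) [DecidableRel G.Adj]

variable (ord : ∀ v : V, Fin (G.degree v) ≃ {d : G.Dart // d.fst = v})

variable {G}

omit [DecidableEq V] in
/-- In a connected graph that is not 2-colorable, any two vertices are joined by a walk of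
even length at most twice the diameter. -/
lemma exists_even_walk_length_le (hconn : G.Connected) (hnb : ¬ G.Colorable 2) (u w : V) :
    ∃ k ≤ G.diam, ∃ p : G.Walk u w, p.length = 2 * k := by
  have hdiam : ∀ a b : V, G.dist a b ≤ G.diam := fun a b => by
    have : Nonempty V := ⟨u⟩
    exact SimpleGraph.dist_le_diam (SimpleGraph.connected_iff_ediam_ne_top.mp hconn)
  obtain ⟨a, b, hab, hpar⟩ : ∃ a b, G.Adj a b ∧ G.dist u a % 2 = G.dist u b % 2 := by
    by_contra! hne
    refine hnb ⟨SimpleGraph.Coloring.mk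
      (fun v => (⟨G.dist u v % 2, Nat.mod_lt _ two_pos⟩ : Fin 2)) fun {a b} hab heq => ?_⟩
    exact hne a b hab (congrArg Fin.val heq)
  obtain ⟨pa, hpa⟩ := hconn.exists_walk_length_eq_dist u a
  obtain ⟨pb, hpb⟩ := hconn.exists_walk_length_eq_dist u b
  obtain ⟨p, hp⟩ := hconn.exists_walk_length_eq_dist b w
  have h1 := hdiam u a
  have h2 := hdiam u b
  have h3 := hdiam b w
  by_cases hev : (G.dist u b + G.dist b w) % 2 = 0
  · refine ⟨(G.dist u b + G.dist b w) / 2, by omega, pb.append p, ?_⟩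
    rw [SimpleGraph.Walk.length_append]
    omega
  · refine ⟨(G.dist u a + 1 + G.dist b w) / 2, by omega, (pa.concat hab).append p, ?_⟩
    rw [SimpleGraph.Walk.length_append, SimpleGraph.Walk.length_concat]
    omega

omit [Fintype V] [DecidableRel G.Adj] in
/-- If arcs with a common tail differ in load by at most one and arcs with a common head `v`
differ by at most `s v`, then along a shortest even walk of length `2 * k` the loads change by at
most `k + 1` plus the sum of `s` over `k` distinct vertices. -/
lemma exists_card_eq_load_le (f : G.Dart → ℕ) (s : V → ℕ)
    (hout : ∀ d d' : G.Dart, d.fst = d'.fst → f d ≤ f d' + 1)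
    (hin : ∀ d d' : G.Dart, d.snd = d'.snd → f d ≤ f d' + s d.snd) (u : V) (k : ℕ) :
    ∀ w : V, (∃ p : G.Walk u w, p.length = 2 * k) →
      (∀ j < k, ¬ ∃ p : G.Walk u w, p.length = 2 * j) →
      ∃ S : Finset V, S.card = k ∧
        (∀ m ∈ S, ∃ j < k, ∃ p : G.Walk u m, p.length = 2 * j + 1) ∧
        ∀ d d' : G.Dart, d.fst = u → d'.fst = w → f d ≤ f d' + (k + 1) + ∑ m ∈ S, s m := by
  induction k with
  | zero =>
    rintro w ⟨p, hp⟩ -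
    obtain rfl := SimpleGraph.Walk.eq_of_length_eq_zero hp
    exact ⟨∅, by simp, by simp, fun d d' hd hd' => by simpa using hout d d' (hd.trans hd'.symm)⟩
  | succ k ih =>
    rintro z ⟨p, hp⟩ hmin
    obtain ⟨w, m, hwm, hmz, q, hq⟩ : ∃ w m : V, G.Adj w m ∧ G.Adj m z ∧
        ∃ q : G.Walk u w, q.length = 2 * k := by
      refine ⟨p.getVert (2 * k), p.getVert (2 * k + 1),
        p.adj_getVert_succ (by omega), ?_, p.take (2 * k), ?_⟩
      · have := p.adj_getVert_succ (i := 2 * k + 1) (by omega)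
        rwa [show 2 * k + 1 + 1 = p.length by omega, p.getVert_length] at this
      · rw [SimpleGraph.Walk.take_length]
        omega
    obtain ⟨S, hcard, hS, hle⟩ := ih w ⟨q, hq⟩ fun j hj ⟨r, hr⟩ =>
      hmin (j + 1) (by omega) ⟨(r.concat hwm).concat hmz, by
        simp only [SimpleGraph.Walk.length_concat]; omega⟩
    have hmS : m ∉ S := fun hm => by
      obtain ⟨j, hj, r, hr⟩ := hS m hm
      exact hmin (j + 1) (by omega) ⟨r.concat hmz, by
        rw [SimpleGraph.Walk.length_concat]; omega⟩
    refine ⟨insert m S, by rw [card_insert_of_notMem hmS, hcard], ?_, ?_⟩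
    · intro v hv
      obtain rfl | hv := mem_insert.mp hv
      · exact ⟨k, by omega, q.concat hwm, by rw [SimpleGraph.Walk.length_concat, hq]⟩
      · obtain ⟨j, hj, r⟩ := hS v hv
        exact ⟨j, by omega, r⟩
    · intro d d' hd hd'
      have h1 := hle d ⟨(w, m), hwm⟩ hd rfl
      have h2 : f ⟨(w, m), hwm⟩ ≤ f ⟨(z, m), hmz.symm⟩ + s m :=
        hin ⟨(w, m), hwm⟩ ⟨(z, m), hmz.symm⟩ rfl
      have h3 := hout ⟨(z, m), hmz.symm⟩ d' hd'.symm
      rw [sum_insert hmS]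
      omega

lemma card_inArcs_eq_card_outArcs (v : V) : (inArcs G v).card = (outArcs G v).card :=
  card_bij (fun d _ => d.symm) (by simp [inArcs, outArcs])
    (fun _ _ _ _ h => SimpleGraph.Dart.symm_involutive.injective h)
    fun d hd => ⟨d.symm, by simpa [inArcs, outArcs] using hd, d.symm_symm⟩

namespace RoundFairProcess

lemma div_le_we (W : RoundFairProcess G) (t : ℕ) (d : G.Dart) :
    W.wv t d.fst / G.degree d.fst ≤ W.we t d := by
  rcases W.fair t d with h | h <;> rw [h]
  have : 0 < G.degree d.fst := (G.degree_pos_iff_exists_adj _).mpr ⟨_, d.adj⟩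
  exact Nat.div_le_div_right (by omega)

lemma we_le_div_add_one (W : RoundFairProcess G) (t : ℕ) (d : G.Dart) :
    W.we t d ≤ W.wv t d.fst / G.degree d.fst + 1 := by
  have : 0 < G.degree d.fst := (G.degree_pos_iff_exists_adj _).mpr ⟨_, d.adj⟩
  rcases W.fair t d with h | h <;> rw [h]
  · omega
  · rw [← Nat.add_div_right _ this]
    exact Nat.div_le_div_right (by omega)

lemma we_le_we_add_one (W : RoundFairProcess G) (t : ℕ) (d d' : G.Dart) (h : d.fst = d'.fst) :
    W.we t d ≤ W.we t d' + 1 := by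
  have h1 := W.we_le_div_add_one t d
  have h2 := W.div_le_we t d'
  rw [h] at h1
  omega

/-- The contribution of the vertex `v` to the potential drop between times `t` and `t + 1`. -/
def drop (W : RoundFairProcess G) (t : ℕ) (v : V) : ℝ :=
  ∑ d ∈ inArcs G v, (W.we t d : ℝ) ^ 2 - ∑ d ∈ outArcs G v, (W.we (t + 1) d : ℝ) ^ 2

lemma sum_drop (W : RoundFairProcess G) (t : ℕ) :
    ∑ v, W.drop t v = (rfPot G W t : ℝ) - (rfPot G W (t + 1) : ℝ) := by
  simp only [drop, rfPot, sum_sub_distrib, Nat.cast_sum, Nat.cast_pow, inArcs, outArcs,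
    sum_fiberwise]

lemma drop_eq (W : RoundFairProcess G) (t : ℕ) (v : V) :
    ∃ q : ℤ, W.drop t v = ∑ d ∈ inArcs G v,
      ((((W.we t d : ℤ) - q) * ((W.we t d : ℤ) - q - 1) : ℤ) : ℝ) := by
  refine ⟨(W.wv (t + 1) v / G.degree v : ℕ), ?_⟩
  set q := W.wv (t + 1) v / G.degree v with hq
  have hzero : ∑ d ∈ outArcs G v,
      ((W.we (t + 1) d : ℝ) - q) * ((W.we (t + 1) d : ℝ) - q - 1) = 0 := by
    refine sum_eq_zero fun d hd => ?_
    obtain rfl : d.fst = v := by simpa [outArcs] using hd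
    have h1 := W.div_le_we (t + 1) d
    have h2 := W.we_le_div_add_one (t + 1) d
    obtain h | h : W.we (t + 1) d = q ∨ W.we (t + 1) d = q + 1 := by omega
    · simp [h]
    · simp [h]
  have hsum : ∑ d ∈ outArcs G v, (W.we (t + 1) d : ℝ) = ∑ d ∈ inArcs G v, (W.we t d : ℝ) := by
    exact_mod_cast (W.sum_out (t + 1) v).symm.trans (W.recv t v)
  have hexp : ∀ a : ℝ, (a - q) * (a - q - 1) = a ^ 2 - (2 * q + 1) * a + q * (q + 1) :=
    fun a => by ring
  have hcard : ((inArcs G v).card : ℝ) = (outArcs G v).card := by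
    rw [card_inArcs_eq_card_outArcs]
  push_cast
  simp only [hexp, sum_add_distrib, sum_sub_distrib, ← mul_sum, sum_const, nsmul_eq_mul]
    at hzero ⊢
  rw [drop, hcard]
  rw [hsum] at hzero
  linarith

lemma drop_summand_nonneg (a q : ℤ) : (0 : ℝ) ≤ (((a - q) * (a - q - 1) : ℤ) : ℝ) := by
  rw [Int.cast_nonneg_iff]
  rcases le_or_gt a q with h | h
  · exact mul_nonneg_of_nonpos_of_nonpos (by omega) (by omega)
  · exact mul_nonneg (by omega) (by omega)

lemma drop_nonneg (W : RoundFairProcess G) (t : ℕ) (v : V) : 0 ≤ W.drop t v := by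
  obtain ⟨q, hq⟩ := W.drop_eq t v
  exact hq ▸ sum_nonneg fun d _ => drop_summand_nonneg _ q

lemma sq_sub_one_div_two_le_drop (W : RoundFairProcess G) (t : ℕ) {v : V} {d d' : G.Dart}
    (hd : d ∈ inArcs G v) (hd' : d' ∈ inArcs G v) :
    (((W.we t d : ℝ) - W.we t d') ^ 2 - 1) / 2 ≤ W.drop t v := by
  rcases eq_or_ne d d' with rfl | hne
  · have := W.drop_nonneg t v
    rw [sub_self]
    linarith
  obtain ⟨q, hq⟩ := W.drop_eq t v
  have hpair := sum_le_sum_of_subset_of_nonneg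
    (f := fun d => ((((W.we t d : ℤ) - q) * ((W.we t d : ℤ) - q - 1) : ℤ) : ℝ))
    (insert_subset hd (singleton_subset_iff.mpr hd'))
    fun d _ _ => drop_summand_nonneg _ q
  rw [← hq, sum_pair hne] at hpair
  push_cast at hpair
  nlinarith [sq_nonneg ((W.we t d : ℝ) + W.we t d' - 2 * q - 1)]

/-- The largest difference of loads between two arcs entering `v`. -/
def inSpread (W : RoundFairProcess G) (t : ℕ) (v : V) : ℕ :=
  (inArcs G v ×ˢ inArcs G v).sup fun p => W.we t p.1 - W.we t p.2

lemma we_le_we_add_inSpread (W : RoundFairProcess G) (t : ℕ) (d d' : G.Dart)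
    (h : d.snd = d'.snd) : W.we t d ≤ W.we t d' + W.inSpread t d.snd := by
  have := le_sup (f := fun p : G.Dart × G.Dart => W.we t p.1 - W.we t p.2)
    (show (d, d') ∈ inArcs G d.snd ×ˢ inArcs G d.snd by simp [inArcs, h])
  have : W.we t d - W.we t d' ≤ W.inSpread t d.snd := this
  omega

lemma inSpread_sq_sub_one_div_two_le_drop (W : RoundFairProcess G) (t : ℕ) (v : V) :
    ((W.inSpread t v : ℝ) ^ 2 - 1) / 2 ≤ W.drop t v := by
  rcases Nat.eq_zero_or_pos (W.inSpread t v) with h | h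
  · have := W.drop_nonneg t v
    rw [h, Nat.cast_zero]
    linarith
  obtain ⟨p, hp, hle⟩ := (Finset.le_sup_iff h).mp le_rfl
  obtain ⟨h1, h2⟩ := mem_product.mp hp
  refine le_trans ?_ (W.sq_sub_one_div_two_le_drop t h1 h2)
  have hle' : W.inSpread t v + W.we t p.2 ≤ W.we t p.1 := by
    have : W.inSpread t v ≤ W.we t p.1 - W.we t p.2 := hle
    omega
  have : (W.inSpread t v : ℝ) ≤ (W.we t p.1 : ℝ) - W.we t p.2 := by
    rw [le_sub_iff_add_le]
    exact_mod_cast hle'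
  gcongr

end RoundFairProcess

variable (G)

/-- For a round-fair process on a finite connected non-bipartite graph
of diameter `D`, if the discrepancy over arcs at time `t` is `x > 4D + 1`, then
`Φ(W_t) − Φ(W_{t+1}) ≥ (x − 4D − 1)(x − 1)/(4D)`. -/
theorem potential_drop_of_discrepancy (hconn : G.Connected) (hnb : ¬ G.Colorable 2)
    (W : RoundFairProcess G) (t x : ℕ) (hx : disc G W t = x)
    (hbig : 4 * G.diam + 1 < x) :
    ((x : ℝ) - 4 * (G.diam : ℝ) - 1) * ((x : ℝ) - 1) / (4 * (G.diam : ℝ)) ≤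
      (rfPot G W t : ℝ) - (rfPot G W (t + 1) : ℝ) := by
  obtain ⟨⟨d, d'⟩, -, hdd⟩ := (Finset.le_sup_iff (show 0 < x by omega)).mp hx.ge
  have hdd' : x + W.we t d' ≤ W.we t d := by
    have : x ≤ W.we t d - W.we t d' := hdd
    omega
  obtain ⟨k₀, hk₀, hwalk₀⟩ := exists_even_walk_length_le hconn hnb d.fst d'.fst
  obtain ⟨k, hk, hwalk, hmin⟩ : ∃ k ≤ G.diam, (∃ p : G.Walk d.fst d'.fst, p.length = 2 * k) ∧
      ∀ j < k, ¬ ∃ p : G.Walk d.fst d'.fst, p.length = 2 * j := by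
    classical
    have hex : ∃ k, ∃ p : G.Walk d.fst d'.fst, p.length = 2 * k := ⟨k₀, hwalk₀⟩
    exact ⟨Nat.find hex, (Nat.find_min' hex hwalk₀).trans hk₀, Nat.find_spec hex,
      fun j hj => Nat.find_min hex hj⟩
  obtain ⟨S, hcard, -, hle⟩ := exists_card_eq_load_le (W.we t) (W.inSpread t)
    (W.we_le_we_add_one t) (W.we_le_we_add_inSpread t) d.fst k d'.fst hwalk hmin
  have hsum : x ≤ k + 1 + ∑ m ∈ S, W.inSpread t m := by
    have := hle d d' rfl rfl
    omega
  have hkpos : 0 < k := by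
    by_contra hk0
    obtain rfl : S = ∅ := card_eq_zero.mp (by omega)
    rw [sum_empty] at hsum
    omega
  have hdrop : (∑ m ∈ S, (W.inSpread t m : ℝ) ^ 2 - k) / 2 ≤
      (rfPot G W t : ℝ) - (rfPot G W (t + 1) : ℝ) := by
    rw [← W.sum_drop t]
    calc (∑ m ∈ S, (W.inSpread t m : ℝ) ^ 2 - k) / 2
        = ∑ m ∈ S, ((W.inSpread t m : ℝ) ^ 2 - 1) / 2 := by
          rw [← sum_div, sum_sub_distrib, sum_const, hcard, nsmul_eq_mul, mul_one]
      _ ≤ ∑ m ∈ S, W.drop t m :=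
          sum_le_sum fun m _ => W.inSpread_sq_sub_one_div_two_le_drop t m
      _ ≤ ∑ m, W.drop t m :=
          sum_le_sum_of_subset_of_nonneg (subset_univ S) fun m _ _ => W.drop_nonneg t m
  refine le_trans ?_ hdrop
  have hcs := sq_sum_le_card_mul_sum_sq (s := S) (f := fun m => (W.inSpread t m : ℝ))
  rw [hcard] at hcs
  set Q : ℝ := ∑ m ∈ S, (W.inSpread t m : ℝ) ^ 2
  have hsum' : (x : ℝ) - 1 - k ≤ ∑ m ∈ S, (W.inSpread t m : ℝ) := by
    have : (x : ℝ) ≤ k + 1 + ∑ m ∈ S, (W.inSpread t m : ℝ) := by exact_mod_cast hsum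
    linarith
  have hkR : (0 : ℝ) < k := by exact_mod_cast hkpos
  have hkD : (k : ℝ) ≤ G.diam := by exact_mod_cast hk
  have hbig' : 4 * (G.diam : ℝ) + 1 < x := by exact_mod_cast hbig
  have hsq : ((x : ℝ) - 1 - k) ^ 2 ≤ k * Q :=
    (pow_le_pow_left₀ (by linarith) hsum' 2).trans hcs
  set y : ℝ := (x : ℝ) - 1 with hy
  set D : ℝ := (G.diam : ℝ)
  have hyD : 0 ≤ y - 4 * D := by linarith
  calc ((x : ℝ) - 4 * D - 1) * y / (4 * D) = (y - 4 * D) * y / (4 * D) := by rw [hy]; ring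
    _ ≤ (y - 2 * k) * y / (2 * k) := by
      have : 0 ≤ y := by linarith
      gcongr
      · exact mul_nonneg (by linarith) this
      · linarith
      · linarith
    _ ≤ (Q - k) / 2 := by
      rw [div_le_div_iff₀ (by positivity) two_pos]
      nlinarith

end RotorRouter
end
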